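/- arXiv:1908.10532 — 5 statements merged into one kernel-verified Lean document; each statement's English description precedes it below -/
import Mathlib

section
/- Let I=[0,1] and let ✶ be the binary operation on L defined as follows. Then ✶ is a t_r-norm on L: it is commutative; associative; has 1_{{1}} as neutral element; is increasing with respect to the partial order ⊑ (if f ⊑ g then f✶h ⊑ g✶h); satisfies 1_{[0,1]} ✶ 1_{[a,b]} = 1_{[0,b]} for all 0 ≤ a ≤ b ≤ 1; is closed on J = {1_{{x}} : x ∈ I}; and is closed on K = {1_{[a,b]} : 0 ≤ a ≤ b ≤ 1}. -/
noncomputable section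

attribute [local instance] Classical.propDecidable

instance : Fact ((0:ℝ) ≤ 1) := ⟨zero_le_one⟩

/-- The unit interval `I = [0,1]`. -/
abbrev I01 := unitInterval

/-- `f^L (x) = sup {f y | y ≤ x}`. -/
def funL (f : I01 → I01) (x : I01) : I01 := sSup (f '' {y | y ≤ x})

/-- `f^R (x) = sup {f y | y ≥ x}`. -/
def funR (f : I01 → I01) (x : I01) : I01 := sSup (f '' {y | x ≤ y})

/-- `f^{Lw}`. -/
def funLw (f : I01 → I01) (x : I01) : I01 :=
  if x = 0 then f 0 else sSup (f '' {y | y < x})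

/-- A function is normal if `sup {f x | x ∈ I} = 1`. -/
def NormalFn (f : I01 → I01) : Prop := sSup (Set.range f) = 1

/-- A function is convex in the fuzzy sense. -/
def ConvexFn (f : I01 → I01) : Prop :=
  ∀ x y z : I01, x ≤ y → y ≤ z → min (f x) (f z) ≤ f y

/-- `L`, the set of all normal and convex functions from `I` to `I`. -/
def NC : Set (I01 → I01) := {f | NormalFn f ∧ ConvexFn f}

/-- Characteristic function of a subset of `I`. -/
def ind (B : Set I01) : I01 → I01 := fun x => if x ∈ B then 1 else 0

/-- `(f ⊓ g)(x) = sup {min (f y) (g z) | min y z = x}`. -/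
def meet (f g : I01 → I01) : I01 → I01 := fun x =>
  sSup {v | ∃ y z : I01, min y z = x ∧ v = min (f y) (g z)}

/-- The partial order `f ⊑ g` iff `f ⊓ g = f`. -/
def sqle (f g : I01 → I01) : Prop := meet f g = f

/-- `η_{f,g}`. -/
def etaLG (f g : I01 → I01) : I01 :=
  min (sInf {x | funL f x = 1}) (sInf {x | funL g x = 1})

/-- `ξ_{f,g}`. -/
def xiLG (f g : I01 → I01) : I01 :=
  min (sSup {x | funR f x = 1}) (sSup {x | funR g x = 1})

/-- The operation `✶`. -/
def starOp (f g : I01 → I01) : I01 → I01 :=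
  if f = ind {1} then g
  else if g = ind {1} then f
  else fun t =>
    if t < etaLG f g then max (funL f t) (funL g t)
    else if t < xiLG f g then 1
    else if t = xiLG f g then min (funR f (xiLG f g)) (funR g (xiLG f g))
    else 0

/-- A t-norm on `I`. -/
structure IsTnormI (op : I01 → I01 → I01) : Prop where
  comm : ∀ x y : I01, op x y = op y x
  assoc : ∀ x y z : I01, op (op x y) z = op x (op y z)
  mono : ∀ x y z : I01, x ≤ y → op x z ≤ op y z ∧ op z x ≤ op z y
  one_op : ∀ x : I01, op 1 x = x
  op_one : ∀ x : I01, op x 1 = x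

/-- A t-conorm on `I`. -/
structure IsTconormI (op : I01 → I01 → I01) : Prop where
  comm : ∀ x y : I01, op x y = op y x
  assoc : ∀ x y z : I01, op (op x y) z = op x (op y z)
  mono : ∀ x y z : I01, x ≤ y → op x z ≤ op y z ∧ op z x ≤ op z y
  zero_op : ∀ x : I01, op 0 x = x
  op_zero : ∀ x : I01, op x 0 = x

/-- The convolution operation `(f ⋏ g)(x) = sup {st (f y) (g z) | tri y z = x}`. -/
def conv (st tri : I01 → I01 → I01) (f g : I01 → I01) : I01 → I01 := fun x =>
  sSup {v | ∃ y z : I01, tri y z = x ∧ v = st (f y) (g z)}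

/-- Complementation `(¬ f)(x) = f (1 - x)`. -/
def negf (f : I01 → I01) : I01 → I01 := fun x => f (unitInterval.symm x)

/-- The dual operation `f ◇^∁ g = ¬((¬f) ◇ (¬g))`. -/
def dualOp (op : (I01 → I01) → (I01 → I01) → (I01 → I01)) :
    (I01 → I01) → (I01 → I01) → (I01 → I01) :=
  fun f g => negf (op (negf f) (negf g))

/-- A t-norm on `L` according to the basic axioms (O1)--(O4). -/
def IsTnormOnL (T : (I01 → I01) → (I01 → I01) → (I01 → I01)) : Prop :=
  (∀ f ∈ NC, ∀ g ∈ NC, T f g = T g f) ∧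
  (∀ f ∈ NC, ∀ g ∈ NC, ∀ h ∈ NC, T (T f g) h = T f (T g h)) ∧
  (∀ f ∈ NC, T f (ind {1}) = f) ∧
  (∀ f ∈ NC, ∀ g ∈ NC, ∀ h ∈ NC, sqle f g → sqle (T f h) (T g h))

/-- A t-conorm on `L` according to the basic axioms (O1), (O2), (O3'), (O4). -/
def IsTconormOnL (S : (I01 → I01) → (I01 → I01) → (I01 → I01)) : Prop :=
  (∀ f ∈ NC, ∀ g ∈ NC, S f g = S g f) ∧
  (∀ f ∈ NC, ∀ g ∈ NC, ∀ h ∈ NC, S (S f g) h = S f (S g h)) ∧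
  (∀ f ∈ NC, S f (ind {0}) = f) ∧
  (∀ f ∈ NC, ∀ g ∈ NC, ∀ h ∈ NC, sqle f g → sqle (S f h) (S g h))

/-- A `t_r`-norm on `L`: an operation on `L` satisfying axioms (O1)--(O7). -/
def IsTrNorm (T : (I01 → I01) → (I01 → I01) → (I01 → I01)) : Prop :=
  (∀ f ∈ NC, ∀ g ∈ NC, T f g ∈ NC) ∧
  (∀ f ∈ NC, ∀ g ∈ NC, T f g = T g f) ∧
  (∀ f ∈ NC, ∀ g ∈ NC, ∀ h ∈ NC, T (T f g) h = T f (T g h)) ∧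
  (∀ f ∈ NC, T f (ind {1}) = f) ∧
  (∀ f ∈ NC, ∀ g ∈ NC, ∀ h ∈ NC, sqle f g → sqle (T f h) (T g h)) ∧
  (∀ a b : I01, a ≤ b → T (ind (Set.Icc 0 1)) (ind (Set.Icc a b)) = ind (Set.Icc 0 b)) ∧
  (∀ x₁ x₂ : I01, ∃ x₃ : I01, T (ind {x₁}) (ind {x₂}) = ind {x₃}) ∧
  (∀ a₁ b₁ a₂ b₂ : I01, a₁ ≤ b₁ → a₂ ≤ b₂ →
    ∃ a₃ b₃ : I01, a₃ ≤ b₃ ∧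
      T (ind (Set.Icc a₁ b₁)) (ind (Set.Icc a₂ b₂)) = ind (Set.Icc a₃ b₃))

/-- A `t_r`-conorm on `L`: an operation on `L` satisfying axioms
(O1), (O2), (O3'), (O4), (O5'), (O6), (O7). -/
def IsTrConorm (S : (I01 → I01) → (I01 → I01) → (I01 → I01)) : Prop :=
  (∀ f ∈ NC, ∀ g ∈ NC, S f g ∈ NC) ∧
  (∀ f ∈ NC, ∀ g ∈ NC, S f g = S g f) ∧
  (∀ f ∈ NC, ∀ g ∈ NC, ∀ h ∈ NC, S (S f g) h = S f (S g h)) ∧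
  (∀ f ∈ NC, S f (ind {0}) = f) ∧
  (∀ f ∈ NC, ∀ g ∈ NC, ∀ h ∈ NC, sqle f g → sqle (S f h) (S g h)) ∧
  (∀ a b : I01, a ≤ b → S (ind (Set.Icc 0 1)) (ind (Set.Icc a b)) = ind (Set.Icc a 1)) ∧
  (∀ x₁ x₂ : I01, ∃ x₃ : I01, S (ind {x₁}) (ind {x₂}) = ind {x₃}) ∧
  (∀ a₁ b₁ a₂ b₂ : I01, a₁ ≤ b₁ → a₂ ≤ b₂ →
    ∃ a₃ b₃ : I01, a₃ ≤ b₃ ∧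
      S (ind (Set.Icc a₁ b₁)) (ind (Set.Icc a₂ b₂)) = ind (Set.Icc a₃ b₃))

theorem le_funL (f : I01 → I01) {x y : I01} (h : y ≤ x) : f y ≤ funL f x :=
  le_sSup ⟨y, h, rfl⟩

theorem le_funR (f : I01 → I01) {x y : I01} (h : x ≤ y) : f y ≤ funR f x :=
  le_sSup ⟨y, h, rfl⟩

theorem funL_le {f : I01 → I01} {x u : I01} (h : ∀ y ≤ x, f y ≤ u) : funL f x ≤ u :=
  sSup_le (by rintro _ ⟨y, hy, rfl⟩; exact h y hy)

theorem funR_le {f : I01 → I01} {x u : I01} (h : ∀ y, x ≤ y → f y ≤ u) : funR f x ≤ u :=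
  sSup_le (by rintro _ ⟨y, hy, rfl⟩; exact h y hy)

theorem funL_mono (f : I01 → I01) : Monotone (funL f) := fun _ _ h =>
  funL_le fun _ hy => le_funL f (hy.trans h)

theorem funR_anti (f : I01 → I01) : Antitone (funR f) := fun _ _ h =>
  funR_le fun _ hy => le_funR f (h.trans hy)

theorem one_le_iff_eq_one {x : I01} : 1 ≤ x ↔ x = 1 :=
  ⟨fun h => le_antisymm unitInterval.le_one' h, fun h => h.ge⟩

theorem normalFn_iff {f : I01 → I01} : NormalFn f ↔ ∀ u < 1, ∃ t, u < f t := by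
  constructor
  · intro h u hu
    rw [← show sSup (Set.range f) = 1 from h] at hu
    obtain ⟨_, ⟨t, rfl⟩, ht⟩ := lt_sSup_iff.1 hu
    exact ⟨t, ht⟩
  · intro h
    refine one_le_iff_eq_one.1 (le_of_forall_lt fun u hu => ?_)
    obtain ⟨t, ht⟩ := h u hu
    exact ht.trans_le (le_sSup ⟨t, rfl⟩)

theorem NormalFn.eq_one_of_forall_le {f : I01 → I01} (hf : NormalFn f) {u : I01}
    (h : ∀ t, f t ≤ u) : u = 1 := by
  by_contra hu
  obtain ⟨t, ht⟩ := normalFn_iff.1 hf u (lt_of_le_of_ne unitInterval.le_one' hu)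
  exact (h t).not_gt ht

theorem funL_eq_one_or_funR_eq_one {f : I01 → I01} (hf : NormalFn f) (t : I01) :
    funL f t = 1 ∨ funR f t = 1 := by
  have h : max (funL f t) (funR f t) = 1 := hf.eq_one_of_forall_le fun y => by
    rcases le_total y t with hy | hy
    · exact le_max_of_le_left (le_funL f hy)
    · exact le_max_of_le_right (le_funR f hy)
  rcases max_choice (funL f t) (funR f t) with h' | h'
  · exact Or.inl (h'.symm.trans h)
  · exact Or.inr (h'.symm.trans h)

theorem min_funL_funR_le {f : I01 → I01} (hf : ConvexFn f) (t : I01) :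
    min (funL f t) (funR f t) ≤ f t := by
  refine le_of_forall_lt fun u hu => ?_
  obtain ⟨hl, hr⟩ := lt_min_iff.1 hu
  obtain ⟨_, ⟨y, hy, rfl⟩, hy'⟩ := lt_sSup_iff.1 hl
  obtain ⟨_, ⟨z, hz, rfl⟩, hz'⟩ := lt_sSup_iff.1 hr
  exact (lt_min hy' hz').trans_le (hf y t z hy hz)

theorem eq_ind_one {f : I01 → I01} (hf : NormalFn f) (h : ∀ x < 1, f x = 0) : f = ind {1} := by
  have h1 : f 1 = 1 := hf.eq_one_of_forall_le fun t => by
    rcases (unitInterval.le_one' : t ≤ 1).lt_or_eq with ht | rfl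
    · rw [h t ht]; exact unitInterval.nonneg'
    · exact le_rfl
  funext x
  rcases (unitInterval.le_one' : x ≤ 1).lt_or_eq with hx | rfl
  · simp [ind, h x hx, hx.ne]
  · simp [ind, h1]

/-- The first point at which `funL f` reaches `1`, up to closure. -/
def peakInf (f : I01 → I01) : I01 := sInf {x | funL f x = 1}

/-- The last point at which `funR f` is still `1`, up to closure. -/
def peakSup (f : I01 → I01) : I01 := sSup {x | funR f x = 1}

/-- `funL f`, made equal to `1` from `peakInf f` on. -/
def lowerEnv (f : I01 → I01) (t : I01) : I01 := if peakInf f ≤ t then 1 else funL f t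

/-- `funR f`, made equal to `0` beyond `peakSup f`. -/
def upperEnv (f : I01 → I01) (t : I01) : I01 := if t ≤ peakSup f then funR f t else 0

theorem funR_eq_one_of_lt {f : I01 → I01} {t : I01} (h : t < peakSup f) : funR f t = 1 := by
  obtain ⟨x, hx, htx⟩ := lt_sSup_iff.1 h
  exact one_le_iff_eq_one.1 (hx.symm.le.trans (funR_anti f htx.le))

theorem peakInf_le_of_eq_one {f : I01 → I01} {t : I01} (h : funL f t = 1) : peakInf f ≤ t :=
  sInf_le h

theorem peakInf_le_peakSup {f : I01 → I01} (hf : NormalFn f) : peakInf f ≤ peakSup f := by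
  by_contra! h
  obtain ⟨t, h1, h2⟩ := exists_between h
  rcases funL_eq_one_or_funR_eq_one hf t with ht | ht
  · exact (peakInf_le_of_eq_one ht).not_gt h2
  · exact (show t ≤ peakSup f from le_sSup ht).not_gt h1

theorem funL_le_lowerEnv (f : I01 → I01) (t : I01) : funL f t ≤ lowerEnv f t := by
  unfold lowerEnv
  split_ifs
  · exact unitInterval.le_one'
  · exact le_rfl

theorem upperEnv_le_funR (f : I01 → I01) (t : I01) : upperEnv f t ≤ funR f t := by
  unfold upperEnv
  split_ifs
  · exact le_rfl
  · exact unitInterval.nonneg'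

theorem lowerEnv_eq_one_iff {f : I01 → I01} {t : I01} : lowerEnv f t = 1 ↔ peakInf f ≤ t := by
  unfold lowerEnv
  split_ifs with h
  · simp [h]
  · exact ⟨peakInf_le_of_eq_one, fun h' => absurd h' h⟩

theorem upperEnv_eq_one_of_lt {f : I01 → I01} {t : I01} (h : t < peakSup f) :
    upperEnv f t = 1 := by
  rw [upperEnv, if_pos h.le, funR_eq_one_of_lt h]

theorem upperEnv_eq_zero {f : I01 → I01} {t : I01} (h : peakSup f < t) : upperEnv f t = 0 :=
  if_neg h.not_ge

theorem lowerEnv_mono (f : I01 → I01) : Monotone (lowerEnv f) := by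
  intro s t h
  by_cases ht : peakInf f ≤ t
  · rw [lowerEnv_eq_one_iff.2 ht]; exact unitInterval.le_one'
  · have hs : ¬ peakInf f ≤ s := fun h' => ht (h'.trans h)
    simpa [lowerEnv, ht, hs] using funL_mono f h

theorem upperEnv_anti (f : I01 → I01) : Antitone (upperEnv f) := by
  intro s t h
  by_cases ht : t ≤ peakSup f
  · simpa [upperEnv, ht, h.trans ht] using funR_anti f h
  · rw [upperEnv_eq_zero (not_le.1 ht)]; exact unitInterval.nonneg'

theorem lowerEnv_eq_one_or_upperEnv_eq_one {f : I01 → I01} (hf : NormalFn f) (t : I01) :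
    lowerEnv f t = 1 ∨ upperEnv f t = 1 := by
  by_cases h : peakInf f ≤ t
  · exact Or.inl (lowerEnv_eq_one_iff.2 h)
  · exact Or.inr (upperEnv_eq_one_of_lt ((not_le.1 h).trans_le (peakInf_le_peakSup hf)))

theorem exists_lt_lowerEnv_upperEnv {f : I01 → I01} (hf : NormalFn f) {u : I01} (hu : u < 1) :
    ∃ t, u < lowerEnv f t ∧ u < upperEnv f t := by
  obtain ⟨y, hy⟩ := normalFn_iff.1 hf u hu
  by_cases h : y ≤ peakSup f
  · refine ⟨y, hy.trans_le ((le_funL f le_rfl).trans (funL_le_lowerEnv f y)), ?_⟩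
    rw [upperEnv, if_pos h]
    exact hy.trans_le (le_funR f le_rfl)
  · refine ⟨peakSup f, ?_, ?_⟩
    · rwa [lowerEnv_eq_one_iff.2 (peakInf_le_peakSup hf)]
    · rw [upperEnv, if_pos le_rfl]
      exact hy.trans_le (le_funR f (not_le.1 h).le)

theorem convexFn_min {a b : I01 → I01} (ha : Monotone a) (hb : Antitone b) :
    ConvexFn fun t => min (a t) (b t) := fun _ _ _ hxy hyz =>
  le_min ((min_le_left _ _).trans ((min_le_left _ _).trans (ha hxy)))
    ((min_le_right _ _).trans ((min_le_right _ _).trans (hb hyz)))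

theorem funL_min {a b : I01 → I01} (ha : Monotone a) (hb : Antitone b)
    (hab : ∀ t, a t = 1 ∨ b t = 1) (hn : NormalFn fun t => min (a t) (b t)) :
    funL (fun t => min (a t) (b t)) = a := by
  funext t
  refine le_antisymm (funL_le fun y hy => (min_le_left _ _).trans (ha hy)) ?_
  have hle := le_funL (fun t => min (a t) (b t)) (le_refl t)
  rcases hab t with h | h
  · refine h.trans_le (hn.eq_one_of_forall_le fun y => ?_).ge
    rcases le_total y t with hy | hy
    · exact le_funL (fun t => min (a t) (b t)) hy
    · exact (min_le_right _ _).trans ((hb hy).trans (by simpa [h, unitInterval.le_one'] using hle))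
  · simpa [h, unitInterval.le_one'] using hle

theorem funR_min {a b : I01 → I01} (ha : Monotone a) (hb : Antitone b)
    (hab : ∀ t, a t = 1 ∨ b t = 1) (hn : NormalFn fun t => min (a t) (b t)) :
    funR (fun t => min (a t) (b t)) = b := by
  funext t
  refine le_antisymm (funR_le fun y hy => (min_le_right _ _).trans (hb hy)) ?_
  have hle := le_funR (fun t => min (a t) (b t)) (le_refl t)
  rcases hab t with h | h
  · simpa [h, unitInterval.le_one'] using hle
  · refine h.trans_le (hn.eq_one_of_forall_le fun y => ?_).ge
    rcases le_total t y with hy | hy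
    · exact le_funR (fun t => min (a t) (b t)) hy
    · exact (min_le_left _ _).trans ((ha hy).trans (by simpa [h, unitInterval.le_one'] using hle))

theorem starOp_of_ne {f g : I01 → I01} (hf : NormalFn f) (hg : NormalFn g)
    (hf1 : f ≠ ind {1}) (hg1 : g ≠ ind {1}) :
    starOp f g = fun t =>
      min (max (lowerEnv f t) (lowerEnv g t)) (min (upperEnv f t) (upperEnv g t)) := by
  have hη : etaLG f g = min (peakInf f) (peakInf g) := rfl
  have hξ : xiLG f g = min (peakSup f) (peakSup g) := rfl
  have hle : etaLG f g ≤ xiLG f g :=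
    min_le_min (peakInf_le_peakSup hf) (peakInf_le_peakSup hg)
  have low : ∀ t, etaLG f g ≤ t → max (lowerEnv f t) (lowerEnv g t) = 1 := by
    intro t ht
    rw [hη, min_le_iff, ← lowerEnv_eq_one_iff, ← lowerEnv_eq_one_iff] at ht
    refine one_le_iff_eq_one.1 ?_
    rcases ht with ht | ht
    · exact ht.ge.trans (le_max_left _ _)
    · exact ht.ge.trans (le_max_right _ _)
  have up : ∀ t, t < xiLG f g → min (upperEnv f t) (upperEnv g t) = 1 := by
    intro t ht
    obtain ⟨h1, h2⟩ := lt_min_iff.1 (hξ ▸ ht)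
    rw [upperEnv_eq_one_of_lt h1, upperEnv_eq_one_of_lt h2, min_self]
  funext t
  rw [starOp, if_neg hf1, if_neg hg1]
  split_ifs with h1 h2 h3
  · rw [up t (h1.trans_le hle), min_eq_left unitInterval.le_one']
    obtain ⟨h1, h2⟩ := lt_min_iff.1 (hη ▸ h1)
    rw [lowerEnv, lowerEnv, if_neg h1.not_ge, if_neg h2.not_ge]
  · rw [up t h2, low t (not_lt.1 h1), min_self]
  · rw [low t (not_lt.1 h1), min_eq_right unitInterval.le_one', ← h3]
    obtain ⟨h1, h2⟩ := le_min_iff.1 (hξ ▸ h3.le)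
    rw [upperEnv, upperEnv, if_pos h1, if_pos h2]
  · have ht : xiLG f g < t := lt_of_le_of_ne (not_lt.1 h2) (Ne.symm h3)
    rw [hξ, min_lt_iff] at ht
    have : min (upperEnv f t) (upperEnv g t) = 0 := by
      refine le_antisymm ?_ unitInterval.nonneg'
      rcases ht with ht | ht
      · exact (min_le_left _ _).trans (upperEnv_eq_zero ht).le
      · exact (min_le_right _ _).trans (upperEnv_eq_zero ht).le
    rw [this, min_eq_right unitInterval.nonneg']

section Star

variable {f g : I01 → I01}

theorem max_lowerEnv_mono (f g : I01 → I01) :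
    Monotone fun t => max (lowerEnv f t) (lowerEnv g t) :=
  (lowerEnv_mono f).max (lowerEnv_mono g)

theorem min_upperEnv_anti (f g : I01 → I01) :
    Antitone fun t => min (upperEnv f t) (upperEnv g t) :=
  (upperEnv_anti f).min (upperEnv_anti g)

theorem max_lowerEnv_eq_one_or (hf : NormalFn f) (hg : NormalFn g) (t : I01) :
    max (lowerEnv f t) (lowerEnv g t) = 1 ∨ min (upperEnv f t) (upperEnv g t) = 1 := by
  rcases lowerEnv_eq_one_or_upperEnv_eq_one hf t with h | h
  · exact Or.inl (by rw [h, max_eq_left unitInterval.le_one'])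
  rcases lowerEnv_eq_one_or_upperEnv_eq_one hg t with h' | h'
  · exact Or.inl (by rw [h', max_eq_right unitInterval.le_one'])
  · exact Or.inr (by rw [h, h', min_self])

theorem normalFn_min_env (hf : NormalFn f) (hg : NormalFn g) :
    NormalFn fun t =>
      min (max (lowerEnv f t) (lowerEnv g t)) (min (upperEnv f t) (upperEnv g t)) := by
  refine normalFn_iff.2 fun u hu => ?_
  obtain ⟨s, hs, hs'⟩ := exists_lt_lowerEnv_upperEnv hf hu
  obtain ⟨t, ht, ht'⟩ := exists_lt_lowerEnv_upperEnv hg hu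
  rcases le_total s t with h | h
  · exact ⟨s, lt_min (lt_max_of_lt_left hs) (lt_min hs' (ht'.trans_le (upperEnv_anti g h)))⟩
  · exact ⟨t, lt_min (lt_max_of_lt_right ht) (lt_min (hs'.trans_le (upperEnv_anti f h)) ht')⟩

theorem ind_one_starOp (g : I01 → I01) : starOp (ind {1}) g = g := if_pos rfl

theorem starOp_ind_one (f : I01 → I01) : starOp f (ind {1}) = f := by
  unfold starOp
  split_ifs with h
  · exact h.symm
  · rfl
  · contradiction

theorem starOp_mem (hf : f ∈ NC) (hg : g ∈ NC) : starOp f g ∈ NC := by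
  by_cases hf1 : f = ind {1}
  · rwa [hf1, ind_one_starOp]
  by_cases hg1 : g = ind {1}
  · rwa [hg1, starOp_ind_one]
  rw [starOp_of_ne hf.1 hg.1 hf1 hg1]
  exact ⟨normalFn_min_env hf.1 hg.1,
    convexFn_min (max_lowerEnv_mono f g) (min_upperEnv_anti f g)⟩

theorem funL_starOp (hf : NormalFn f) (hg : NormalFn g)
    (hf1 : f ≠ ind {1}) (hg1 : g ≠ ind {1}) :
    funL (starOp f g) = fun t => max (lowerEnv f t) (lowerEnv g t) := by
  rw [starOp_of_ne hf hg hf1 hg1]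
  exact funL_min (max_lowerEnv_mono f g) (min_upperEnv_anti f g)
    (max_lowerEnv_eq_one_or hf hg) (normalFn_min_env hf hg)

theorem funR_starOp (hf : NormalFn f) (hg : NormalFn g)
    (hf1 : f ≠ ind {1}) (hg1 : g ≠ ind {1}) :
    funR (starOp f g) = fun t => min (upperEnv f t) (upperEnv g t) := by
  rw [starOp_of_ne hf hg hf1 hg1]
  exact funR_min (max_lowerEnv_mono f g) (min_upperEnv_anti f g)
    (max_lowerEnv_eq_one_or hf hg) (normalFn_min_env hf hg)

theorem peakInf_starOp (hf : NormalFn f) (hg : NormalFn g)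
    (hf1 : f ≠ ind {1}) (hg1 : g ≠ ind {1}) :
    peakInf (starOp f g) = min (peakInf f) (peakInf g) := by
  have h : {x | funL (starOp f g) x = 1} = Set.Ici (min (peakInf f) (peakInf g)) := by
    ext t
    rw [funL_starOp hf hg hf1 hg1, Set.mem_ofPred_eq, Set.mem_Ici, min_le_iff,
      ← lowerEnv_eq_one_iff, ← lowerEnv_eq_one_iff, ← one_le_iff_eq_one, le_max_iff,
      one_le_iff_eq_one, one_le_iff_eq_one]
  rw [peakInf, h, csInf_Ici]

theorem min_peakSup_le_peakSup_starOp (hf : NormalFn f) (hg : NormalFn g)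
    (hf1 : f ≠ ind {1}) (hg1 : g ≠ ind {1}) :
    min (peakSup f) (peakSup g) ≤ peakSup (starOp f g) := by
  refine le_of_forall_lt_imp_le_of_dense fun s hs => le_sSup ?_
  obtain ⟨h1, h2⟩ := lt_min_iff.1 hs
  rw [Set.mem_ofPred_eq, funR_starOp hf hg hf1 hg1]
  simp only [upperEnv_eq_one_of_lt h1, upperEnv_eq_one_of_lt h2, min_self]

theorem lowerEnv_starOp (hf : NormalFn f) (hg : NormalFn g)
    (hf1 : f ≠ ind {1}) (hg1 : g ≠ ind {1}) (t : I01) :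
    lowerEnv (starOp f g) t = max (lowerEnv f t) (lowerEnv g t) := by
  rw [← congrFun (funL_starOp hf hg hf1 hg1) t, lowerEnv]
  split_ifs with h
  · rw [funL_starOp hf hg hf1 hg1]
    rw [peakInf_starOp hf hg hf1 hg1, min_le_iff, ← lowerEnv_eq_one_iff,
      ← lowerEnv_eq_one_iff, ← one_le_iff_eq_one, ← one_le_iff_eq_one, ← le_max_iff,
      one_le_iff_eq_one] at h
    exact h.symm
  · rfl

theorem upperEnv_starOp (hf : NormalFn f) (hg : NormalFn g)
    (hf1 : f ≠ ind {1}) (hg1 : g ≠ ind {1}) (t : I01) :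
    upperEnv (starOp f g) t = min (upperEnv f t) (upperEnv g t) := by
  rw [upperEnv]
  split_ifs with h
  · rw [funR_starOp hf hg hf1 hg1]
  · refine le_antisymm (le_min unitInterval.nonneg' unitInterval.nonneg') ?_
    have h' := (min_peakSup_le_peakSup_starOp hf hg hf1 hg1).trans_lt (not_le.1 h)
    rcases min_lt_iff.1 h' with h' | h'
    · exact (min_le_left _ _).trans (upperEnv_eq_zero h').le
    · exact (min_le_right _ _).trans (upperEnv_eq_zero h').le

theorem starOp_ne_ind_one (hf : NormalFn f) (hg : NormalFn g)
    (hf1 : f ≠ ind {1}) (hg1 : g ≠ ind {1}) :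
    starOp f g ≠ ind {1} := by
  intro h
  refine hf1 (eq_ind_one hf fun x hx => le_antisymm ?_ unitInterval.nonneg')
  have hfx : f x ≤ funL (starOp f g) x := by
    rw [funL_starOp hf hg hf1 hg1]
    exact (le_funL f le_rfl).trans ((funL_le_lowerEnv f x).trans (le_max_left _ _))
  refine hfx.trans (funL_le fun y hy => ?_)
  simp [h, ind, (hy.trans_lt hx).ne]

end Star

theorem starOp_comm {f g : I01 → I01} (hf : NormalFn f) (hg : NormalFn g) :
    starOp f g = starOp g f := by
  by_cases hf1 : f = ind {1}
  · rw [hf1, ind_one_starOp, starOp_ind_one]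
  by_cases hg1 : g = ind {1}
  · rw [hg1, ind_one_starOp, starOp_ind_one]
  rw [starOp_of_ne hf hg hf1 hg1, starOp_of_ne hg hf hg1 hf1]
  funext t
  rw [max_comm, min_comm (upperEnv f t)]

theorem starOp_assoc {f g h : I01 → I01} (hf : f ∈ NC) (hg : g ∈ NC) (hh : h ∈ NC) :
    starOp (starOp f g) h = starOp f (starOp g h) := by
  by_cases hf1 : f = ind {1}
  · rw [hf1, ind_one_starOp, ind_one_starOp]
  by_cases hg1 : g = ind {1}
  · rw [hg1, ind_one_starOp, starOp_ind_one]
  by_cases hh1 : h = ind {1}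
  · rw [hh1, starOp_ind_one, starOp_ind_one]
  rw [starOp_of_ne (starOp_mem hf hg).1 hh.1 (starOp_ne_ind_one hf.1 hg.1 hf1 hg1) hh1,
    starOp_of_ne hf.1 (starOp_mem hg hh).1 hf1 (starOp_ne_ind_one hg.1 hh.1 hg1 hh1)]
  funext t
  rw [lowerEnv_starOp hf.1 hg.1 hf1 hg1, lowerEnv_starOp hg.1 hh.1 hg1 hh1,
    upperEnv_starOp hf.1 hg.1 hf1 hg1, upperEnv_starOp hg.1 hh.1 hg1 hh1, max_assoc, min_assoc]

theorem min_le_meet (f g : I01 → I01) (y z : I01) : min (f y) (g z) ≤ meet f g (min y z) :=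
  le_sSup ⟨y, z, rfl, rfl⟩

theorem sqle_iff {f g : I01 → I01} (hf : f ∈ NC) :
    sqle f g ↔ funL g ≤ funL f ∧ funR f ≤ funR g := by
  constructor
  · intro h
    have hfg : ∀ y z, min (f y) (g z) ≤ f (min y z) := fun y z => by
      simpa only [show meet f g = f from h] using min_le_meet f g y z
    refine ⟨fun t => funL_le fun z hz => le_of_forall_lt fun u hu => ?_,
      fun t => funR_le fun x hx => ?_⟩
    · obtain ⟨y, hy⟩ := normalFn_iff.1 hf.1 u (hu.trans_le unitInterval.le_one')
      exact (lt_min hy hu).trans_le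
        ((hfg y z).trans (le_funL f ((min_le_right y z).trans hz)))
    · rw [← show meet f g x = f x from congrFun h x]
      refine sSup_le ?_
      rintro _ ⟨y, z, hyz, rfl⟩
      exact (min_le_right _ _).trans (le_funR g (hx.trans (hyz.ge.trans (min_le_right y z))))
  · rintro ⟨hl, hr⟩
    funext x
    refine le_antisymm (sSup_le ?_) (le_of_forall_lt fun u hu => ?_)
    · rintro _ ⟨y, z, hyz, rfl⟩
      rcases min_choice y z with h | h
      · rw [← hyz, h]; exact min_le_left _ _
      · obtain rfl : z = x := h.symm.trans hyz
        refine le_trans (le_min ?_ ?_) (min_funL_funR_le hf.2 z)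
        · exact (min_le_right _ _).trans ((le_funL g le_rfl).trans (hl z))
        · exact (min_le_left _ _).trans (le_funR f (hyz.ge.trans (min_le_left y z)))
    · obtain ⟨_, ⟨z, hz, rfl⟩, hz'⟩ :=
        lt_sSup_iff.1 (hu.trans_le ((le_funR f le_rfl).trans (hr x)))
      have := min_le_meet f g x z
      rw [min_eq_left (show x ≤ z from hz)] at this
      exact (lt_min hu hz').trans_le this

theorem lowerEnv_le_lowerEnv {f g : I01 → I01} (h : funL g ≤ funL f) :
    lowerEnv g ≤ lowerEnv f := by
  have hp : peakInf f ≤ peakInf g :=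
    sInf_le_sInf fun t ht => one_le_iff_eq_one.1 ((show funL g t = 1 from ht).ge.trans (h t))
  intro t
  by_cases ht : peakInf f ≤ t
  · rw [lowerEnv_eq_one_iff.2 ht]; exact unitInterval.le_one'
  · rw [lowerEnv, lowerEnv, if_neg ht, if_neg fun h' => ht (hp.trans h')]
    exact h t

theorem upperEnv_le_upperEnv {f g : I01 → I01} (h : funR f ≤ funR g) :
    upperEnv f ≤ upperEnv g := by
  have hp : peakSup f ≤ peakSup g :=
    sSup_le_sSup fun t ht => one_le_iff_eq_one.1 ((show funR f t = 1 from ht).ge.trans (h t))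
  intro t
  by_cases ht : t ≤ peakSup f
  · rw [upperEnv, upperEnv, if_pos ht, if_pos (ht.trans hp)]
    exact h t
  · rw [upperEnv_eq_zero (not_le.1 ht)]; exact unitInterval.nonneg'

theorem sqle_refl {f : I01 → I01} (hf : f ∈ NC) : sqle f f :=
  (sqle_iff hf).2 ⟨le_rfl, le_rfl⟩

theorem eq_ind_one_of_sqle {g : I01 → I01} (h1 : ind {1} ∈ NC) (hg : NormalFn g)
    (h : sqle (ind {1}) g) : g = ind {1} := by
  refine eq_ind_one hg fun x hx => le_antisymm ?_ unitInterval.nonneg'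
  refine (le_funL g le_rfl).trans ((((sqle_iff h1).1 h).1 x).trans (funL_le fun y hy => ?_))
  simp [ind, (hy.trans_lt hx).ne]

theorem starOp_sqle_starOp {f g h : I01 → I01} (hf : f ∈ NC) (hg : g ∈ NC) (hh : h ∈ NC)
    (hfg : sqle f g) : sqle (starOp f h) (starOp g h) := by
  by_cases hh1 : h = ind {1}
  · rwa [hh1, starOp_ind_one, starOp_ind_one]
  by_cases hf1 : f = ind {1}
  · subst hf1
    rw [eq_ind_one_of_sqle hf hg.1 hfg]
    exact sqle_refl (starOp_mem hf hh)
  obtain ⟨hl, hr⟩ := (sqle_iff hf).1 hfg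
  rw [sqle_iff (starOp_mem hf hh), funL_starOp hf.1 hh.1 hf1 hh1,
    funR_starOp hf.1 hh.1 hf1 hh1]
  by_cases hg1 : g = ind {1}
  · rw [hg1, ind_one_starOp]
    exact ⟨fun t => (funL_le_lowerEnv h t).trans (le_max_right _ _),
      fun t => (min_le_right _ _).trans (upperEnv_le_funR h t)⟩
  · rw [funL_starOp hg.1 hh.1 hg1 hh1, funR_starOp hg.1 hh.1 hg1 hh1]
    exact ⟨fun t => max_le_max_right _ (lowerEnv_le_lowerEnv hl t),
      fun t => min_le_min_right _ (upperEnv_le_upperEnv hr t)⟩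

section Interval

variable {a b : I01}

theorem normalFn_ind_Icc (h : a ≤ b) : NormalFn (ind (Set.Icc a b)) :=
  normalFn_iff.2 fun u hu => ⟨a, by simpa [ind, h] using hu⟩

theorem funL_ind_Icc (h : a ≤ b) (t : I01) :
    funL (ind (Set.Icc a b)) t = if a ≤ t then 1 else 0 := by
  split_ifs with ht
  · refine one_le_iff_eq_one.1 (le_trans ?_ (le_funL _ ht))
    simp [ind, h]
  · refine le_antisymm (funL_le fun y hy => ?_) unitInterval.nonneg'
    simp [ind, (hy.trans_lt (not_le.1 ht)).not_ge]

theorem funR_ind_Icc (h : a ≤ b) (t : I01) :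
    funR (ind (Set.Icc a b)) t = if t ≤ b then 1 else 0 := by
  split_ifs with ht
  · refine one_le_iff_eq_one.1 (le_trans ?_ (le_funR _ ht))
    simp [ind, h]
  · refine le_antisymm (funR_le fun y hy => ?_) unitInterval.nonneg'
    simp [ind, ((not_le.1 ht).trans_le hy).not_ge]

theorem lowerEnv_ind_Icc (h : a ≤ b) (t : I01) :
    lowerEnv (ind (Set.Icc a b)) t = if a ≤ t then 1 else 0 := by
  have hp : peakInf (ind (Set.Icc a b)) = a := by
    have : {x | funL (ind (Set.Icc a b)) x = 1} = Set.Ici a := by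
      ext t; simp [funL_ind_Icc h]
    rw [peakInf, this, csInf_Ici]
  rw [lowerEnv, hp, funL_ind_Icc h]
  split_ifs <;> rfl

theorem upperEnv_ind_Icc (h : a ≤ b) (t : I01) :
    upperEnv (ind (Set.Icc a b)) t = if t ≤ b then 1 else 0 := by
  have hp : peakSup (ind (Set.Icc a b)) = b := by
    have : {x | funR (ind (Set.Icc a b)) x = 1} = Set.Iic b := by
      ext t; simp [funR_ind_Icc h]
    rw [peakSup, this, csSup_Iic]
  rw [upperEnv, hp, funR_ind_Icc h]
  split_ifs <;> rfl

theorem ind_Icc_eq_ind_one (h : a ≤ b) (h1 : ind (Set.Icc a b) = ind {1}) : a = 1 ∧ b = 1 := by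
  have mem : ∀ x, x ∈ Set.Icc a b → x = 1 := fun x hx => by
    simpa [ind, hx] using congrFun h1 x
  exact ⟨mem a ⟨le_rfl, h⟩, mem b ⟨h, le_rfl⟩⟩

theorem starOp_ind_Icc {a₁ b₁ a₂ b₂ : I01} (h₁ : a₁ ≤ b₁) (h₂ : a₂ ≤ b₂) :
    starOp (ind (Set.Icc a₁ b₁)) (ind (Set.Icc a₂ b₂)) =
      ind (Set.Icc (min a₁ a₂) (min b₁ b₂)) := by
  by_cases hf1 : ind (Set.Icc a₁ b₁) = ind {1}
  · obtain ⟨rfl, rfl⟩ := ind_Icc_eq_ind_one h₁ hf1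
    rw [hf1, ind_one_starOp, min_eq_right unitInterval.le_one', min_eq_right unitInterval.le_one']
  by_cases hg1 : ind (Set.Icc a₂ b₂) = ind {1}
  · obtain ⟨rfl, rfl⟩ := ind_Icc_eq_ind_one h₂ hg1
    rw [hg1, starOp_ind_one, min_eq_left unitInterval.le_one', min_eq_left unitInterval.le_one']
  rw [starOp_of_ne (normalFn_ind_Icc h₁) (normalFn_ind_Icc h₂) hf1 hg1]
  funext t
  rw [lowerEnv_ind_Icc h₁, lowerEnv_ind_Icc h₂, upperEnv_ind_Icc h₁, upperEnv_ind_Icc h₂]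
  by_cases p₁ : a₁ ≤ t <;> by_cases p₂ : a₂ ≤ t <;> by_cases q₁ : t ≤ b₁ <;>
    by_cases q₂ : t ≤ b₂ <;> simp [ind, p₁, p₂, q₁, q₂]

end Interval

/-- the operation `✶` is a `t_r`-norm on `L`. -/
theorem stmt0 : IsTrNorm starOp := by
  refine ⟨fun f hf g hg => starOp_mem hf hg, fun f hf g hg => starOp_comm hf.1 hg.1,
    fun f hf g hg h hh => starOp_assoc hf hg hh, fun f _ => starOp_ind_one f,
    fun f hf g hg h hh => starOp_sqle_starOp hf hg hh, fun a b hab => ?_, fun x₁ x₂ => ?_,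
    fun a₁ b₁ a₂ b₂ h₁ h₂ => ⟨_, _, min_le_min h₁ h₂, starOp_ind_Icc h₁ h₂⟩⟩
  · rw [starOp_ind_Icc unitInterval.nonneg' hab, min_eq_left unitInterval.nonneg',
      min_eq_right unitInterval.le_one']
  · refine ⟨min x₁ x₂, ?_⟩
    simpa only [Set.Icc_self] using starOp_ind_Icc (le_refl x₁) (le_refl x₂)
end
end

section
/- Let * be a binary operation on I, Δ a t-norm on I, and ∇ a t-conorm on I. Then: (1) the operation ⋎ defined by (f⋎g)(x) = sup{f(y)*g(z) : y ∇ z = x} is not a t-norm on L, i.e., it does not satisfy all of commutativity, associativity, neutral element 1_{{1}}, and monotonicity with respect to ⊑; (2) the operation ⋏ defined by (f⋏g)(x) = sup{f(y)*g(z) : y Δ z = x} is not a t-conorm on L, i.e., it does not satisfy all of commutativity, associativity, neutral element 1_{{0}}, and monotonicity with respect to ⊑. -/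
noncomputable section

attribute [local instance] Classical.propDecidable

theorem ind_singleton_mem_NC (e : I01) : ind {e} ∈ NC := by
  refine ⟨le_antisymm le_top (le_sSup ⟨e, by simp [ind]⟩), fun x y z hxy hyz => ?_⟩
  by_cases hx : x = e
  · by_cases hz : z = e
    · have hy : y = e := le_antisymm (hz ▸ hyz) (hx ▸ hxy)
      simp [ind, hx, hy, hz]
    · exact (min_le_right _ _).trans (by simp [ind, hz])
  · exact (min_le_left _ _).trans (by simp [ind, hx])

/-- If `e` is left neutral for `op` and cannot be written as `op y z` in a nontrivial way, then
`ind {e'}` with `e' ≠ e` is not right neutral for the convolution, whatever `st` is. -/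
theorem conv_ind_singleton_ne (st op : I01 → I01 → I01) {e e' a : I01}
    (hop : ∀ x, op e x = x) (hext : ∀ y z, op y z = e → y = e ∧ z = e)
    (he : e ≠ e') (hae : a ≠ e) (hae' : a ≠ e') :
    conv st op (ind {e}) (ind {e'}) ≠ ind {e} := by
  intro h
  have hst : st 1 0 = 1 := by
    have hset : {v | ∃ y z : I01, op y z = e ∧ v = st (ind {e} y) (ind {e'} z)} = {st 1 0} := by
      ext v
      constructor
      · rintro ⟨y, z, hyz, rfl⟩
        obtain ⟨rfl, rfl⟩ := hext y z hyz
        simp [ind, he]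
      · rintro rfl
        exact ⟨e, e, hop e, by simp [ind, he]⟩
    have h_at := congrFun h e
    rw [conv, hset, sSup_singleton] at h_at
    simpa [ind] using h_at
  have hle : (1 : I01) ≤ conv st op (ind {e}) (ind {e'}) a :=
    le_sSup ⟨e, a, hop a, by simp [ind, hae', hst]⟩
  rw [h] at hle
  simp [ind, hae] at hle

/-- `⋎` is not a t-norm on `L`, and `⋏` is not a t-conorm on `L`. -/
theorem stmt2 (st tri nab : I01 → I01 → I01)
    (htri : IsTnormI tri) (hnab : IsTconormI nab) :
    ¬ IsTnormOnL (conv st nab) ∧ ¬ IsTconormOnL (conv st tri) := by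
  obtain ⟨a, ha0, ha1⟩ := exists_between (zero_lt_one : (0 : I01) < 1)
  refine ⟨fun h => ?_, fun h => ?_⟩
  · refine conv_ind_singleton_ne st nab hnab.zero_op (fun y z hyz => ?_) zero_ne_one
      ha0.ne' ha1.ne (h.2.2.1 _ (ind_singleton_mem_NC 0))
    have hy := (hnab.mono 0 z y bot_le).2
    have hz := (hnab.mono 0 y z bot_le).1
    rw [hnab.op_zero, hyz] at hy
    rw [hnab.zero_op, hyz] at hz
    exact ⟨le_antisymm hy bot_le, le_antisymm hz bot_le⟩
  · refine conv_ind_singleton_ne st tri htri.one_op (fun y z hyz => ?_) one_ne_zero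
      ha1.ne ha0.ne' (h.2.2.1 _ (ind_singleton_mem_NC 1))
    have hy := (htri.mono z 1 y le_top).2
    have hz := (htri.mono y 1 z le_top).1
    rw [htri.op_one, hyz] at hy
    rw [htri.one_op, hyz] at hz
    exact ⟨le_antisymm le_top hy, le_antisymm le_top hz⟩
end
end

section
/- For all f, g ∈ L, the function f✶g is normal and convex, i.e., f✶g ∈ L (the operation ✶ is closed on L). -/
noncomputable section

attribute [local instance] Classical.propDecidable

/-- If `f` is normal, then of two bounds for `f`, one on each side of `t`, one must be `1`. -/
theorem NormalFn.eq_one_or_eq_one {f : I01 → I01} (hf : NormalFn f) {t c d : I01}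
    (hc : ∀ y < t, f y ≤ c) (hd : ∀ y, t ≤ y → f y ≤ d) : c = 1 ∨ d = 1 := by
  have h : (1 : I01) ≤ max c d := by
    rw [← show sSup (Set.range f) = 1 from hf]
    refine sSup_le ?_
    rintro _ ⟨y, rfl⟩
    rcases lt_or_ge y t with hy | hy
    · exact (hc y hy).trans (le_max_left _ _)
    · exact (hd y hy).trans (le_max_right _ _)
  rcases le_max_iff.1 h with h | h
  · exact Or.inl (le_antisymm unitInterval.le_one' h)
  · exact Or.inr (le_antisymm unitInterval.le_one' h)

theorem NormalFn.sInf_funL_le_sSup_funR {f : I01 → I01} (hf : NormalFn f) :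
    sInf {x | funL f x = 1} ≤ sSup {x | funR f x = 1} := by
  by_contra! h
  obtain ⟨t, h₁, h₂⟩ := exists_between h
  rcases hf.eq_one_or_eq_one (t := t) (fun _ hy => le_funL f hy.le)
    (fun _ hy => le_funR f hy) with ht | ht
  · exact absurd h₂ (not_lt_of_ge (sInf_le ht))
  · exact absurd h₁ (not_lt_of_ge (le_sSup ht))

theorem etaLG_le_xiLG {f g : I01 → I01} (hf : NormalFn f) (hg : NormalFn g) :
    etaLG f g ≤ xiLG f g :=
  min_le_min hf.sInf_funL_le_sSup_funR hg.sInf_funL_le_sSup_funR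

/-- A function that increases up to `a`, is `1` on `[a, b)` and vanishes beyond `b` is convex. -/
theorem convexFn_piecewise {u : I01 → I01} (hu : Monotone u) (a b c : I01) :
    ConvexFn fun t => if t < a then u t else if t < b then 1 else if t = b then c else 0 := by
  intro x y z hxy hyz
  dsimp only
  by_cases hya : y < a
  · rw [if_pos hya, if_pos (hxy.trans_lt hya)]
    exact min_le_of_left_le (hu hxy)
  by_cases hyb : y < b
  · rw [if_neg hya, if_pos hyb]
    exact unitInterval.le_one'
  rcases hyz.eq_or_lt with rfl | hyz
  · exact min_le_right _ _
  have hz : b < z := (not_lt.1 hyb).trans_lt hyz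
  rw [if_neg fun h : z < a => hya (hyz.trans h), if_neg hz.not_gt, if_neg hz.ne']
  exact min_le_of_right_le unitInterval.nonneg'

theorem normalFn_piecewise {f g : I01 → I01} (hf : NormalFn f) (hg : NormalFn g)
    {a b : I01} (hab : a ≤ b) :
    NormalFn fun t => if t < a then max (funL f t) (funL g t) else if t < b then 1
      else if t = b then min (funR f b) (funR g b) else 0 := by
  set s : I01 → I01 := fun t => if t < a then max (funL f t) (funL g t) else if t < b then 1
      else if t = b then min (funR f b) (funR g b) else 0 with hs
  have le_s (t : I01) : s t ≤ sSup (Set.range s) := le_sSup ⟨t, rfl⟩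
  have h_left (y : I01) (hy : y < a) : max (f y) (g y) ≤ sSup (Set.range s) := by
    refine le_trans ?_ (le_s y)
    simp only [hs, if_pos hy]
    exact max_le_max (le_funL f le_rfl) (le_funL g le_rfl)
  rcases hab.lt_or_eq with hab | rfl
  · refine le_antisymm unitInterval.le_one' ((le_of_eq ?_).trans (le_s a))
    simp [hs, hab]
  · rcases hf.eq_one_or_eq_one (fun y hy => (le_max_left _ _).trans (h_left y hy))
      (fun y hy => le_funR f hy) with h | hfR
    · exact h
    rcases hg.eq_one_or_eq_one (fun y hy => (le_max_right _ _).trans (h_left y hy))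
      (fun y hy => le_funR g hy) with h | hgR
    · exact h
    refine le_antisymm unitInterval.le_one' ((le_of_eq ?_).trans (le_s a))
    simp [hs, hfR, hgR]

/-- `✶` is closed on `L`. -/
theorem stmt6 (f g : I01 → I01) (hf : f ∈ NC) (hg : g ∈ NC) :
    starOp f g ∈ NC := by
  unfold starOp
  split_ifs
  · exact hg
  · exact hf
  · exact ⟨normalFn_piecewise hf.1 hg.1 (etaLG_le_xiLG hf.1 hg.1),
      convexFn_piecewise ((funL_mono f).max (funL_mono g)) _ _ _⟩
end
end

section
/- Let Δ be a t-norm on I and * a binary operation on I, and define (f⋏g)(x) = sup{f(y)*g(z) : y Δ z = x}. If ⋏ is commutative on L (i.e., f⋏g = g⋏f for all f, g ∈ L), then * is commutative. -/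
noncomputable section

attribute [local instance] Classical.propDecidable

/-- The function taking the value `1` at `0` and `a` elsewhere. -/
def oneAtZero (a : I01) : I01 → I01 := fun t => if t = 0 then 1 else a

theorem oneAtZero_antitone (a : I01) : Antitone (oneAtZero a) := by
  intro s t hst
  unfold oneAtZero
  split_ifs with ht hs
  · exact le_rfl
  · exact absurd (le_antisymm (hst.trans ht.le) unitInterval.nonneg') hs
  · exact unitInterval.le_one'
  · exact le_rfl

theorem oneAtZero_mem_NC (a : I01) : oneAtZero a ∈ NC := by
  refine ⟨le_antisymm unitInterval.le_one' (le_sSup ⟨0, by simp [oneAtZero]⟩), ?_⟩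
  intro x y z _ hyz
  exact (min_le_right _ _).trans (oneAtZero_antitone a hyz)

theorem oneAtZero_one (a : I01) : oneAtZero a 1 = a := by
  simp [oneAtZero]

theorem IsTnormI.eq_one_iff {op : I01 → I01 → I01} (h : IsTnormI op) {y z : I01} :
    op y z = 1 ↔ y = 1 ∧ z = 1 := by
  refine ⟨fun hyz => ⟨?_, ?_⟩, fun ⟨hy, hz⟩ => by rw [hy, hz, h.one_op]⟩
  · have := (h.mono z 1 y unitInterval.le_one').2
    rw [hyz, h.op_one] at this
    exact le_antisymm unitInterval.le_one' this
  · have := (h.mono y 1 z unitInterval.le_one').1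
    rw [hyz, h.one_op] at this
    exact le_antisymm unitInterval.le_one' this

theorem conv_one (st tri : I01 → I01 → I01) (htri : IsTnormI tri) (f g : I01 → I01) :
    conv st tri f g 1 = st (f 1) (g 1) := by
  simp only [conv, htri.eq_one_iff, and_assoc, exists_and_left, exists_eq_left,
    Set.ofPred_eq_eq_singleton, sSup_singleton]

/-- if `⋏` is commutative on `L`, then `*` is commutative. -/
theorem stmt18 (st tri : I01 → I01 → I01) (htri : IsTnormI tri)
    (hcomm : ∀ f ∈ NC, ∀ g ∈ NC, conv st tri f g = conv st tri g f) :
    ∀ x y : I01, st x y = st y x := by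
  intro x y
  have h := congrFun (hcomm _ (oneAtZero_mem_NC x) _ (oneAtZero_mem_NC y)) 1
  simpa only [conv_one st tri htri, oneAtZero_one] using h
end
end

section
/- Let Δ be a t-norm on I and * a binary operation on I, and define (f⋏g)(x) = sup{f(y)*g(z) : y Δ z = x}. If ⋏ is a t-norm on L (i.e., commutative, associative, with neutral element 1_{{1}}, and increasing with respect to ⊑), then for all x₁, x₂ ∈ I, 1_{{x₁}} ⋏ 1_{{x₂}} = 1_{{x₁ Δ x₂}}. -/
noncomputable section

attribute [local instance] Classical.propDecidable

lemma ind_singleton_one_mem_NC : ind {1} ∈ NC := by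
  refine ⟨le_antisymm le_top (le_sSup ⟨1, by simp [ind]⟩), fun x y z hxy _ => ?_⟩
  by_cases hx : x = 1
  · subst hx
    have hy : y = 1 := le_antisymm le_top hxy
    simp [hy, ind, unitInterval.le_one']
  · simp [ind, hx]

lemma IsTnormI.zero_op {op : I01 → I01 → I01} (h : IsTnormI op) (x : I01) : op 0 x = 0 :=
  le_antisymm (((h.mono x 1 0 unitInterval.le_one').2).trans_eq (h.op_one 0))
    unitInterval.nonneg'

lemma IsTnormI.eq_one_of_op_eq_one {op : I01 → I01 → I01} (h : IsTnormI op) {x y : I01}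
    (hxy : op x y = 1) : x = 1 ∧ y = 1 := by
  have hx := (h.mono y 1 x unitInterval.le_one').2
  have hy := (h.mono x 1 y unitInterval.le_one').1
  rw [hxy, h.op_one] at hx
  rw [hxy, h.one_op] at hy
  exact ⟨le_antisymm unitInterval.le_one' hx, le_antisymm unitInterval.le_one' hy⟩

/-- If `1_{{1}}` is idempotent for the convolution, then `st` restricts to conjunction on
`{0, 1}`. -/
lemma boolean_values_of_conv_ind_one {st tri : I01 → I01 → I01} (htri : IsTnormI tri)
    (h : conv st tri (ind {1}) (ind {1}) = ind {1}) :
    st 0 0 = 0 ∧ st 0 1 = 0 ∧ st 1 0 = 0 ∧ st 1 1 = 1 := by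
  have key (y z : I01) (hyz : tri y z = 0) : st (ind {1} y) (ind {1} z) = 0 := by
    have hle : st (ind {1} y) (ind {1} z) ≤ conv st tri (ind {1}) (ind {1}) 0 :=
      le_sSup ⟨y, z, hyz, rfl⟩
    rw [h] at hle
    exact le_antisymm (by simpa [ind] using hle) unitInterval.nonneg'
  refine ⟨by simpa [ind] using key 0 0 (htri.zero_op 0),
    by simpa [ind] using key 0 1 (htri.zero_op 1),
    by simpa [ind] using key 1 0 (htri.one_op 0), ?_⟩
  have hset : {v | ∃ y z : I01, tri y z = 1 ∧ v = st (ind {1} y) (ind {1} z)} = {st 1 1} := by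
    ext v
    constructor
    · rintro ⟨y, z, hyz, rfl⟩
      obtain ⟨rfl, rfl⟩ := htri.eq_one_of_op_eq_one hyz
      simp [ind]
    · rintro rfl
      exact ⟨1, 1, htri.one_op 1, by simp [ind]⟩
  have h1 := congrFun h 1
  rw [conv, hset, sSup_singleton] at h1
  simpa [ind] using h1

/-- if `⋏` is a t-norm on `L`, then `1_{{x₁}} ⋏ 1_{{x₂}} = 1_{{x₁ Δ x₂}}`. -/
theorem stmt19 (st tri : I01 → I01 → I01) (htri : IsTnormI tri)
    (h : IsTnormOnL (conv st tri)) :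
    ∀ x₁ x₂ : I01, conv st tri (ind {x₁}) (ind {x₂}) = ind {tri x₁ x₂} := by
  intro x₁ x₂
  obtain ⟨h00, h01, h10, h11⟩ := boolean_values_of_conv_ind_one htri
    (h.2.2.1 _ ind_singleton_one_mem_NC)
  have hval (y z : I01) :
      st (ind {x₁} y) (ind {x₂} z) = if y = x₁ ∧ z = x₂ then 1 else 0 := by
    by_cases hy : y = x₁ <;> by_cases hz : z = x₂ <;> simp [ind, *]
  funext x
  refine le_antisymm (sSup_le ?_) ?_
  · rintro v ⟨y, z, rfl, rfl⟩
    rw [hval]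
    split_ifs with hyz
    · simp [ind, hyz.1, hyz.2]
    · exact unitInterval.nonneg'
  · by_cases hx : x = tri x₁ x₂
    · refine le_sSup ⟨x₁, x₂, hx.symm, ?_⟩
      simp [ind, hx, h11]
    · simp [ind, hx]
end
end
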